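/- Let d ≥ 1 and let v_0, v_1, …, v_d be distinct nonzero vectors in ℤ^d with v_1, …, v_d linearly independent over ℚ, and suppose the set A := {0, v_0, v_1, …, v_d} (of d+2 elements) generates ℤ^d as an additive group. Then (H : ℝ) = d! · vol(Δ_A), where vol(Δ_A) is the d-dimensional Lebesgue measure of the convex hull of A in ℝ^d. -/

import Mathlib

open Pointwise MeasureTheory

/-- The truncated cone `C_k = {n₁v₁ + ⋯ + n_d v_d : nᵢ ∈ ℕ, n₁ + ⋯ + n_d ≤ k}`. -/
def truncCone {d : ℕ} (v : Fin d → Fin d → ℤ) (k : ℕ) : Set (Fin d → ℤ) :=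
  {x | ∃ n : Fin d → ℕ, (∑ i, n i) ≤ k ∧ x = ∑ i, (n i) • v i}

/-- The translated truncated cone `A_{j,h} = j·v₀ + C_{h-j}` (empty if `j > h`). -/
def truncA {d : ℕ} (v0 : Fin d → ℤ) (v : Fin d → Fin d → ℤ) (j h : ℕ) :
    Set (Fin d → ℤ) :=
  if j ≤ h then (fun x => j • v0 + x) '' truncCone v (h - j) else ∅


theorem hullWeights {ι E : Type*} [Fintype ι] [DecidableEq ι] [AddCommGroup E] [Module ℝ E]
    (p : ι → E) (s : Set ι) (x : E) :
    x ∈ convexHull ℝ (p '' s) ↔ ∃ w : ι → ℝ, (∀ i, 0 ≤ w i) ∧ ∑ i, w i = 1 ∧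
      (∀ i, i ∉ s → w i = 0) ∧ ∑ i, w i • p i = x := by
  classical
  constructor
  · intro hx
    have : convexHull ℝ (p '' s) ⊆ {x | ∃ w : ι → ℝ, (∀ i, 0 ≤ w i) ∧ ∑ i, w i = 1 ∧
      (∀ i, i ∉ s → w i = 0) ∧ ∑ i, w i • p i = x} := by
      apply convexHull_min
      · rintro _ ⟨i, hi, rfl⟩
        refine ⟨Pi.single i 1, ?_, ?_, ?_, ?_⟩
        · intro j
          by_cases h : j = i
          · subst h; simp
          · simp [h]
        · simp
        · intro j hj
          have : j ≠ i := fun h => hj (h ▸ hi)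
          simp [this]
        · simp [Pi.single_apply]
      · rintro _ ⟨w, hw0, hw1, hws, rfl⟩ _ ⟨u, hu0, hu1, hus, rfl⟩ a b ha hb hab
        refine ⟨fun i => a * w i + b * u i, ?_, ?_, ?_, ?_⟩
        · intro i; have := hw0 i; have := hu0 i; positivity
        · rw [Finset.sum_add_distrib, ← Finset.mul_sum, ← Finset.mul_sum, hw1, hu1]; linarith
        · intro i hi; simp [hws i hi, hus i hi]
        · simp [add_smul, mul_smul, Finset.sum_add_distrib, Finset.smul_sum]
    exact this hx
  · rintro ⟨w, hw0, hw1, hws, rfl⟩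
    have h1 : ∑ i with i ∈ s, w i = 1 := by
      rw [← hw1]
      apply Finset.sum_subset (Finset.subset_univ _)
      intro i _ hi; exact hws i (by simpa using hi)
    have h2 : ∑ i with i ∈ s, w i • p i = ∑ i, w i • p i := by
      apply Finset.sum_subset (Finset.subset_univ _)
      intro i _ hi; rw [hws i (by simpa using hi), zero_smul]
    rw [← h2]
    apply (convex_convexHull ℝ _).sum_mem (fun i _ => hw0 i) h1
    intro i hi
    exact subset_convexHull ℝ _ ⟨i, by simpa using hi, rfl⟩

/-- The corner simplex. -/
def cornerS (d : ℕ) : Set (Fin d → ℝ) := {x | (∀ i, 0 ≤ x i) ∧ ∑ i, x i ≤ 1}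

theorem cornerS_measurable (d : ℕ) : MeasurableSet (cornerS d) := by
  apply IsClosed.measurableSet
  apply IsClosed.inter
  · have : {x : Fin d → ℝ | ∀ i, 0 ≤ x i} = ⋂ i, {x | 0 ≤ x i} := by ext; simp
    show IsClosed {x : Fin d → ℝ | ∀ i, 0 ≤ x i}
    rw [this]
    exact isClosed_iInter fun i => isClosed_le continuous_const (continuous_apply i)
  · exact isClosed_le (f := fun x : Fin d → ℝ => ∑ i, x i) (by fun_prop) continuous_const

theorem cornerS_eq_hull (d : ℕ) : cornerS d =
    convexHull ℝ (insert 0 (Set.range (fun i => Pi.single i (1:ℝ)))) := by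
  have : (insert 0 (Set.range (fun i => Pi.single i (1:ℝ))) : Set (Fin d → ℝ)) =
      (fun o : Option (Fin d) => o.elim 0 (fun i => Pi.single i (1:ℝ))) '' Set.univ := by
    ext x; simp [Option.exists, eq_comm]
  rw [this]
  ext x
  rw [hullWeights]
  constructor
  · rintro ⟨h0, h1⟩
    refine ⟨fun o => o.elim (1 - ∑ i, x i) x, ?_, ?_, ?_, ?_⟩
    · rintro (_ | i)
      · simpa using h1
      · exact h0 i
    · simp [Fintype.sum_option]
    · simp
    · ext j; simp [Fintype.sum_option, Finset.sum_apply, Pi.single_apply]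
  · rintro ⟨w, h0, h1, -, rfl⟩
    have : ∀ j, (∑ o : Option (Fin d), w o • (o.elim 0 (fun i => Pi.single i (1:ℝ)) : Fin d → ℝ)) j
        = w (some j) := by
      intro j; simp [Fintype.sum_option, Finset.sum_apply, Pi.single_apply]
    simp only [Fintype.sum_option] at h1
    refine ⟨fun i => by rw [this]; exact h0 _, ?_⟩
    simp only [this]
    linarith [h0 none]

theorem volume_cornerS (d : ℕ) (hd : 1 ≤ d) :
    volume (cornerS d) = ENNReal.ofReal (1 / (d.factorial : ℝ)) := by
  have : Nonempty (Fin d) := ⟨⟨0, hd⟩⟩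
  have hx := MeasureTheory.volume_sum_rpow_le (Fin d) (p := 1) le_rfl 1
  simp only [Real.rpow_one, div_one, ENNReal.ofReal_one, one_pow, Fintype.card_fin, one_mul,
    Real.Gamma_nat_eq_factorial] at hx
  have hG : Real.Gamma (1 + 1) = 1 := by
    have := Real.Gamma_nat_eq_factorial 1
    simpa using this
  rw [hG, mul_one] at hx
  let L : (Fin d → Bool) → (Fin d → ℝ) →ₗ[ℝ] (Fin d → ℝ) := fun ε =>
    Matrix.toLin' (Matrix.diagonal fun i => if ε i then (1:ℝ) else -1)
  have hL : ∀ ε x i, L ε x i = (if ε i then (1:ℝ) else -1) * x i := by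
    intro ε x i
    simp only [L, Matrix.toLin'_apply, Matrix.mulVec_diagonal]
  have hLL : ∀ ε x, L ε (L ε x) = x := by
    intro ε x; ext i; rw [hL, hL]; split_ifs <;> ring
  have hLm : ∀ ε, L ε '' cornerS d = L ε ⁻¹' cornerS d := by
    intro ε; ext y
    constructor
    · rintro ⟨x, hx, rfl⟩; simpa [hLL] using hx
    · intro h; exact ⟨L ε y, h, hLL _ _⟩
  have hunion : {x : Fin d → ℝ | ∑ i, |x i| ≤ 1} =
      ⋃ ε ∈ (Finset.univ : Finset (Fin d → Bool)), L ε '' cornerS d := by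
    ext x
    simp only [Set.mem_ofPred_eq, Finset.mem_univ, Set.iUnion_true, Set.mem_iUnion, hLm,
      Set.mem_preimage]
    constructor
    · intro h
      have key : ∀ i, L (fun i => decide (0 ≤ x i)) x i = |x i| := by
        intro i; rw [hL]
        by_cases h0 : 0 ≤ x i
        · simp [h0, abs_of_nonneg h0]
        · simp [h0, abs_of_neg (not_le.mp h0)]
      refine ⟨fun i => decide (0 ≤ x i), fun i => ?_, ?_⟩
      · rw [key]; positivity
      · simpa only [key] using h
    · rintro ⟨ε, h0, h1⟩
      have key : ∀ i, |x i| = L ε x i := by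
        intro i; rw [← abs_of_nonneg (h0 i), hL]
        split_ifs <;> simp
      simpa only [key] using h1
  have hvol : ∀ ε, volume (L ε '' cornerS d) = volume (cornerS d) := by
    intro ε
    rw [Measure.addHaar_image_linearMap]
    have : |LinearMap.det (L ε)| = 1 := by
      simp only [L, LinearMap.det_toLin', Matrix.det_diagonal, Finset.abs_prod]
      apply Finset.prod_eq_one
      intro i _; split_ifs <;> simp
    simp [this]
  rw [hunion, measure_biUnion_finset₀] at hx
  · simp only [hvol, Finset.sum_const, Finset.card_univ, Fintype.card_fun, Fintype.card_bool,
      Fintype.card_fin, nsmul_eq_mul] at hx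
    have h2 : (2:ℝ)^d / (d.factorial:ℝ) = (2:ℝ)^d * (1 / (d.factorial : ℝ)) := by ring
    rw [h2, ENNReal.ofReal_mul (by positivity), ENNReal.ofReal_pow (by norm_num)] at hx
    push_cast at hx
    rw [ENNReal.ofReal_ofNat] at hx
    exact (ENNReal.mul_right_inj (by simp) (by simp)).mp hx
  · intro ε _ ε' _ hne
    obtain ⟨i, hi⟩ := Function.ne_iff.mp hne
    refine measure_mono_null ?_ (Measure.pi_hyperplane (fun _ : Fin d => (volume : Measure ℝ)) i 0)
    rintro x ⟨h1, h2⟩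
    simp only [hLm] at h1 h2
    have a1 := h1.1 i
    have a2 := h2.1 i
    rw [hL] at a1 a2
    show x i = 0
    cases h : ε i <;> cases h' : ε' i <;> simp_all <;> linarith
  · intro ε _
    rw [hLm]
    exact ((L ε).continuous_of_finiteDimensional.measurable (cornerS_measurable d)).nullMeasurableSet

theorem volume_simplex (d : ℕ) (hd : 1 ≤ d) (q0 : Fin d → ℝ) (q : Fin d → Fin d → ℝ) :
    volume (convexHull ℝ (insert q0 (Set.range q))) =
      ENNReal.ofReal (|(Matrix.of fun i => q i - q0).det| * (1 / (d.factorial : ℝ))) := by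
  let L : (Fin d → ℝ) →ₗ[ℝ] (Fin d → ℝ) := Matrix.toLin' (Matrix.of fun i => q i - q0).transpose
  have : insert q0 (Set.range q) = (fun x => q0 + x) ''
      (L '' (insert 0 (Set.range (fun i => Pi.single i (1:ℝ))))) := by
    rw [Set.image_insert_eq, Set.image_insert_eq, ← Set.range_comp, ← Set.range_comp]
    congr 1
    · simp
    · congr 1; ext i j
      simp [L, Matrix.toLin'_apply]
  have e : (fun x => q0 + x) '' (L '' (insert 0 (Set.range (fun i => Pi.single i (1:ℝ))))) =
    q0 +ᵥ (L '' (insert 0 (Set.range (fun i => Pi.single i (1:ℝ))))) := rfl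
  rw [this, e, convexHull_vadd, ← LinearMap.image_convexHull, ← cornerS_eq_hull, measure_vadd,
    Measure.addHaar_image_linearMap, volume_cornerS d hd, ENNReal.ofReal_mul (abs_nonneg _)]
  simp only [L, LinearMap.det_toLin', Matrix.det_transpose]

theorem volume_triangulate {ι : Type*} [Fintype ι] [DecidableEq ι] (d : ℕ) (hd : 1 ≤ d)
    (hcard : Fintype.card ι = d + 2) (p : ι → Fin d → ℝ) (a : ι → ℝ) (ha : ∑ i, a i = 0)
    (hap : ∑ i, a i • p i = 0)
    (huniq : ∀ b : ι → ℝ, ∑ i, b i = 0 → ∑ i, b i • p i = 0 → ∃ t : ℝ, ∀ i, b i = t * a i)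
    (hex : ∃ i, 0 < a i) :
    volume (convexHull ℝ (Set.range p)) =
      ∑ i with 0 < a i, volume (convexHull ℝ (p '' {i}ᶜ)) := by
  have hunion : convexHull ℝ (Set.range p) =
      ⋃ i ∈ Finset.univ.filter (fun i => 0 < a i), convexHull ℝ (p '' {i}ᶜ) := by
    apply Set.Subset.antisymm
    · intro x hx
      rw [← Set.image_univ, hullWeights] at hx
      obtain ⟨w, h0, h1, -, rfl⟩ := hx
      obtain ⟨i, hi, hmin⟩ := Finset.exists_min_image (Finset.univ.filter (fun i => 0 < a i))
        (fun i => w i / a i) (by obtain ⟨i, hi⟩ := hex; exact ⟨i, by simpa using hi⟩)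
      have hi' : 0 < a i := by simpa using hi
      refine Set.mem_biUnion hi ?_
      rw [hullWeights]
      refine ⟨fun k => w k - (w i / a i) * a k, ?_, ?_, ?_, ?_⟩
      · intro k
        by_cases hk : 0 < a k
        · have := hmin k (by simpa using hk)
          rw [le_div_iff₀ hk] at this
          simp only at this ⊢; linarith
        · have h2 : 0 ≤ w i / a i := div_nonneg (h0 i) hi'.le
          have := mul_nonpos_of_nonneg_of_nonpos h2 (not_lt.mp hk)
          simp only; linarith [h0 k]
      · rw [Finset.sum_sub_distrib, ← Finset.mul_sum, ha, h1]; simp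
      · intro k hk
        have : k = i := by simpa using hk
        subst this; field_simp; simp
      · simp only [sub_smul, mul_smul, Finset.sum_sub_distrib, ← Finset.smul_sum, hap]
        simp
    · refine Set.iUnion₂_subset fun i _ => convexHull_mono (Set.image_subset_range _ _)
  rw [hunion, measure_biUnion_finset₀]
  · intro i hi j hj hij
    have hi' : 0 < a i := by simpa using hi
    have hj' : 0 < a j := by simpa using hj
    let s : Finset ι := {i, j}ᶜ
    have hs : s.card = (d - 1) + 1 := by
      simp only [s, Finset.card_compl, hcard, Finset.card_pair hij]; omega
    have hfr := finrank_vectorSpan_image_finset_le ℝ p s hs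
    refine measure_mono_null ?_
      (Measure.addHaar_affineSubspace volume (affineSpan ℝ (s.image p : Set (Fin d → ℝ))) ?_)
    · rintro x ⟨hx1, hx2⟩
      simp only [hullWeights] at hx1 hx2
      obtain ⟨w, w0, w1, ws, rfl⟩ := hx1
      obtain ⟨u, u0, u1, us, hu⟩ := hx2
      obtain ⟨t, ht⟩ := huniq (fun k => w k - u k) (by rw [Finset.sum_sub_distrib, w1, u1, sub_self])
        (by simp only [sub_smul, Finset.sum_sub_distrib, hu, sub_self])
      have e1 := ht i
      have e2 := ht j
      have wi := ws i (by simp)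
      have uj := us j (by simp)
      have t1 : t ≤ 0 := by
        by_contra h; push Not at h
        have := mul_pos h hi'; linarith [u0 i]
      have t2 : 0 ≤ t := by
        by_contra h; push Not at h
        have := mul_neg_of_neg_of_pos h hj'; linarith [w0 j]
      have t0 : t = 0 := le_antisymm t1 t2
      subst t0
      apply convexHull_subset_affineSpan
      rw [Finset.coe_image, hullWeights]
      refine ⟨w, w0, w1, ?_, rfl⟩
      intro k hk
      have : k = i ∨ k = j := by
        by_contra h; apply hk; simp only [s, Finset.coe_compl, Set.mem_compl_iff]; simpa using h
      rcases this with rfl | rfl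
      · exact wi
      · linarith
    · intro htop
      have h3 : vectorSpan ℝ (s.image p : Set (Fin d → ℝ)) = ⊤ := by
        rw [← direction_affineSpan, htop, AffineSubspace.direction_top]
      rw [h3, finrank_top, Module.finrank_fin_fun] at hfr
      omega
  · intro i _
    apply MeasurableSet.nullMeasurableSet
    exact ((Set.toFinite _).isCompact_convexHull (𝕜 := ℝ)).isClosed.measurableSet

theorem volume_circuit (d : ℕ) (hd : 1 ≤ d) (c : Fin d → ℝ) :
    volume (convexHull ℝ (insert 0 (insert c (Set.range (fun i => Pi.single i (1:ℝ)))))) =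
      ENNReal.ofReal ((1 + ∑ i, max (-c i) 0 + max (∑ i, c i - 1) 0) * (1 / (d.factorial : ℝ))) := by
  let p : Option (Option (Fin d)) → Fin d → ℝ := fun o => o.elim 0 (fun o => o.elim c
    (fun i => Pi.single i (1:ℝ)))
  let a : Option (Option (Fin d)) → ℝ := fun o => o.elim (∑ i, c i - 1) (fun o => o.elim 1
    (fun i => -c i))
  have hp : (insert 0 (insert c (Set.range (fun i => Pi.single i (1:ℝ))))) = Set.range p := by
    ext x; simp [p, Option.exists, eq_comm]
  have hv : ∀ o, volume (convexHull ℝ (p '' {o}ᶜ)) =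
      ENNReal.ofReal (|a o| * (1 / (d.factorial : ℝ))) := by
    rintro (_ | _ | i)
    · have : p '' {none}ᶜ = insert c (Set.range (fun i => Pi.single i (1:ℝ))) := by
        ext x; simp [p, Option.exists, eq_comm]
      rw [this, volume_simplex d hd]
      congr 2
      have h := Matrix.det_one_add_replicateCol_mul_replicateRow (ι := Unit)
        (fun _ : Fin d => (1:ℝ)) (-c)
      have h' : (1 + Matrix.replicateCol Unit (fun _ : Fin d => (1:ℝ)) *
          Matrix.replicateRow Unit (-c)) =
          (Matrix.of fun i => Pi.single i (1:ℝ) - c) := by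
        ext i j
        simp [Matrix.mul_apply, Matrix.one_apply, Pi.single_apply, sub_eq_add_neg, eq_comm]
      rw [← h', h]
      simp only [dotProduct, a, Option.elim]
      rw [abs_sub_comm]
      congr 1
      simp [sub_eq_add_neg]
    · have : p '' {some none}ᶜ = insert 0 (Set.range (fun i => Pi.single i (1:ℝ))) := by
        ext x; simp [p, Option.exists, eq_comm]
      rw [this, volume_simplex d hd]
      congr 2
      have h' : (Matrix.of fun i : Fin d => Pi.single i (1:ℝ) - 0) =
         (1 : Matrix (Fin d) (Fin d) ℝ) := by
        ext i j
        simp [Matrix.one_apply, Pi.single_apply, eq_comm]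
      rw [h']; simp [a]
    · have : p '' {some (some i)}ᶜ = insert 0 (Set.range
          (Function.update (fun i => Pi.single i (1:ℝ)) i c)) := by
        ext x
        constructor
        · rintro ⟨(_ | _ | j), hj, rfl⟩
          · left; rfl
          · right; exact ⟨i, by simp [p]⟩
          · right
            have : j ≠ i := by simpa using hj
            exact ⟨j, by simp [p, this]⟩
        · rintro (rfl | ⟨j, rfl⟩)
          · exact ⟨none, by simp, rfl⟩
          · by_cases h : j = i
            · subst h; exact ⟨some none, by simp, by simp [p]⟩
            · exact ⟨some (some j), by simpa using h, by simp [p, h]⟩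
      rw [this, volume_simplex d hd]
      congr 2
      have h' : (Matrix.of fun k : Fin d =>
          Function.update (fun i => (Pi.single i (1:ℝ) : Fin d → ℝ)) i c k - 0) =
         (1 : Matrix (Fin d) (Fin d) ℝ).updateRow i c := by
        ext k j
        by_cases h : k = i
        · subst h; simp
        · simp [h, Matrix.one_apply, Pi.single_apply, eq_comm]
      rw [h', ← Matrix.det_transpose, ← Matrix.updateCol_transpose, ← Matrix.cramer_apply]
      simp [a]
  rw [hp, volume_triangulate d hd (by simp) p a]
  · simp only [hv]
    rw [← ENNReal.ofReal_sum_of_nonneg (fun i _ => by positivity), ← Finset.sum_mul]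
    congr 2
    rw [Finset.sum_filter]
    have : ∀ o, (if 0 < a o then |a o| else 0) = max (a o) 0 := by
      intro o
      split_ifs with h
      · rw [abs_of_pos h, max_eq_left h.le]
      · rw [max_eq_right (not_lt.mp h)]
    simp only [this, Fintype.sum_option]
    simp only [a, Option.elim]
    rw [max_eq_left (zero_le_one)]; ring
  · simp only [a, Fintype.sum_option, Option.elim, Finset.sum_neg_distrib]; ring
  · ext j; simp [a, p, Fintype.sum_option, Finset.sum_apply, Pi.single_apply]
  · intro b b1 b2
    have h3 : ∀ j, b (some none) * c j + b (some (some j)) = 0 := by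
      intro j
      have := congrFun b2 j
      simpa [p, Fintype.sum_option, Finset.sum_apply, Pi.single_apply] using this
    have h4 : ∀ j, b (some (some j)) = - b (some none) * c j := fun j => by linarith [h3 j]
    refine ⟨b (some none), ?_⟩
    rintro (_ | _ | j)
    · simp only [Fintype.sum_option, h4, ← Finset.mul_sum] at b1
      simp only [a, Option.elim]; linarith
    · simp [a]
    · rw [h4]; simp [a]
  · exact ⟨some none, by simp [a]⟩

theorem lattice_order (d : ℕ) (v0 : Fin d → ℤ) (v : Fin d → Fin d → ℤ)
    (hli : LinearIndependent ℤ v)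
    (hgen : AddSubgroup.closure (insert 0 (insert v0 (Set.range v))) =
      (⊤ : AddSubgroup (Fin d → ℤ))) (t : ℕ) :
    (∃ s : Fin d → ℤ, t • v0 = ∑ i, s i • v i) ↔ (Matrix.of v).det.natAbs ∣ t := by
  let N : Submodule ℤ (Fin d → ℤ) := Submodule.span ℤ (Set.range v)
  have hcard := Submodule.natAbs_det_basis_change (Pi.basisFun ℤ (Fin d)) N (Module.Basis.span hli)
  have h1 : (Pi.basisFun ℤ (Fin d)).det ((↑) ∘ (Module.Basis.span hli)) = (Matrix.of v).det := by
    rw [Pi.basisFun_det]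
    congr 1
    ext i j
    simp [Module.Basis.span_apply]
  rw [h1] at hcard
  have hcyc : ∀ x : (Fin d → ℤ) ⧸ N, x ∈ AddSubgroup.zmultiples (N.mkQ v0 : (Fin d → ℤ) ⧸ N) := by
    intro x
    obtain ⟨y, rfl⟩ := N.mkQ_surjective x
    have hy : y ∈ (AddSubgroup.zmultiples (N.mkQ v0)).comap N.mkQ.toAddMonoidHom := by
      have hle : (⊤ : AddSubgroup (Fin d → ℤ)) ≤
          (AddSubgroup.zmultiples (N.mkQ v0)).comap N.mkQ.toAddMonoidHom := by
        rw [← hgen, AddSubgroup.closure_le]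
        rintro z (rfl | rfl | ⟨i, rfl⟩)
        · exact zero_mem _
        · exact AddSubgroup.mem_zmultiples _
        · show N.mkQ (v i) ∈ AddSubgroup.zmultiples (N.mkQ v0 : (Fin d → ℤ) ⧸ N)
          have : N.mkQ (v i) = 0 := by
            rw [Submodule.mkQ_apply, Submodule.Quotient.mk_eq_zero]
            exact Submodule.subset_span ⟨i, rfl⟩
          rw [this]; exact zero_mem _
      exact hle (AddSubgroup.mem_top _)
    exact hy
  rw [hcard, ← addOrderOf_eq_card_of_forall_mem_zmultiples hcyc, addOrderOf_dvd_iff_nsmul_eq_zero,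
    ← map_nsmul, Submodule.mkQ_apply, Submodule.Quotient.mk_eq_zero,
    Submodule.mem_span_range_iff_exists_fun]
  simp only [eq_comm]

theorem height_formula (d : ℕ) (v0 : Fin d → ℤ) (v : Fin d → Fin d → ℤ)
    (hli : LinearIndependent ℤ v) (D : ℕ) (hD : 0 < D) (b : Fin d → ℤ)
    (hb : D • v0 = ∑ i, b i • v i)
    (hdvd : ∀ t : ℕ, (∃ s : Fin d → ℤ, t • v0 = ∑ i, s i • v i) → D ∣ t)
    (H : ℕ)
    (hH : IsLeast {l : ℕ | ∃ j j' : ℕ, j < j' ∧ j' ≤ l ∧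
      (truncA v0 v j l ∩ truncA v0 v j' l).Nonempty} H) :
    (H : ℤ) = D + ∑ i, max (-b i) 0 + max (∑ i, b i - D) 0 := by
  have hsum : ∑ i, max (b i) 0 = ∑ i, max (-b i) 0 + ∑ i, b i := by
    rw [← Finset.sum_add_distrib]
    apply Finset.sum_congr rfl; intro i _
    rcases le_total (b i) 0 with h | h
    · rw [max_eq_right h, max_eq_left (by omega)]; omega
    · rw [max_eq_left h, max_eq_right (by omega)]; omega
  obtain ⟨⟨j, j', hjj, hjl, x, hx1, hx2⟩, hmin⟩ := hH
  apply le_antisymm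
  · have h0 : (0:ℤ) ≤ D + ∑ i, max (-b i) 0 + max (∑ i, b i - D) 0 := by
      have : (0:ℤ) ≤ ∑ i, max (-b i) 0 := Finset.sum_nonneg fun i _ => le_max_right _ _
      positivity
    obtain ⟨M, hM⟩ := Int.eq_ofNat_of_zero_le h0
    rw [hM]
    norm_cast
    apply hmin
    have n1 : ((∑ i, (b i).toNat : ℕ) : ℤ) = ∑ i, max (b i) 0 := by simp
    have n2 : ((∑ i, (-b i).toNat : ℕ) : ℤ) = ∑ i, max (-b i) 0 := by simp
    refine ⟨0, D, hD, ?_, D • v0 + ∑ i, (-b i).toNat • v i, ?_, ?_⟩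
    · omega
    · rw [truncA, if_pos (Nat.zero_le _)]
      refine ⟨_, ⟨fun i => (b i).toNat, ?_, rfl⟩, ?_⟩
      · show ∑ i, (b i).toNat ≤ M - 0
        omega
      · simp only [zero_smul, zero_add]
        rw [hb, ← Finset.sum_add_distrib]
        apply Finset.sum_congr rfl; intro i _
        rw [← natCast_zsmul, ← natCast_zsmul, ← add_smul]
        congr 1; omega
    · rw [truncA, if_pos (by omega)]
      refine ⟨_, ⟨fun i => (-b i).toNat, ?_, rfl⟩, rfl⟩
      show ∑ i, (-b i).toNat ≤ M - D
      omega
  · rw [truncA, if_pos (by omega)] at hx1 hx2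
    obtain ⟨_, ⟨n, hn, rfl⟩, rfl⟩ := hx1
    obtain ⟨_, ⟨m, hm, rfl⟩, he⟩ := hx2
    obtain ⟨t, rfl⟩ := Nat.exists_eq_add_of_lt hjj
    have he2 : (t + 1) • v0 = ∑ i, ((n i : ℤ) - m i) • v i := by
      simp only [sub_smul, Finset.sum_sub_distrib, natCast_zsmul]
      simp only at he
      rw [eq_sub_iff_add_eq]
      apply add_left_cancel (a := j • v0)
      rw [← he, ← add_assoc, ← add_smul, add_assoc j t 1]
    obtain ⟨k, hk⟩ := hdvd _ ⟨_, he2⟩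
    have hk1 : 1 ≤ k := by
      rcases Nat.eq_zero_or_pos k with h | h
      · subst h; simp at hk
      · exact h
    have hnm : ∀ i, (n i : ℤ) - m i = k * b i := by
      have h0 : ∑ i, ((n i : ℤ) - m i - k * b i) • v i = 0 := by
        simp only [sub_smul _ ((k:ℤ) * _), Finset.sum_sub_distrib]
        rw [← he2, hk, mul_comm, mul_smul, hb, Finset.smul_sum, sub_eq_zero]
        apply Finset.sum_congr rfl; intro i _
        rw [mul_smul, natCast_zsmul]
      intro i
      have := Fintype.linearIndependent_iff.mp hli _ h0 i
      linarith
    have hn1 : ∀ i, max (b i) 0 ≤ n i := by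
      intro i
      have h1 := hnm i
      rcases le_total (b i) 0 with h | h
      · rw [max_eq_right h]; omega
      · rw [max_eq_left h]; have : 1 * b i ≤ k * b i := by gcongr; exact_mod_cast hk1
        omega
    have hm1 : ∀ i, max (-b i) 0 ≤ m i := by
      intro i
      have h1 := hnm i
      rcases le_total (-b i) 0 with h | h
      · rw [max_eq_right h]; omega
      · rw [max_eq_left h]; have : 1 * (-b i) ≤ k * (-b i) := by gcongr; exact_mod_cast hk1
        linarith [mul_neg (k : ℤ) (b i), Int.natCast_nonneg (n i)]
    have s1 : ∑ i, max (b i) 0 ≤ ((∑ i, n i : ℕ) : ℤ) := by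
      push_cast; exact Finset.sum_le_sum fun i _ => hn1 i
    have s2 : ∑ i, max (-b i) 0 ≤ ((∑ i, m i : ℕ) : ℤ) := by
      push_cast; exact Finset.sum_le_sum fun i _ => hm1 i
    have hDk : D ≤ t + 1 := by rw [hk]; exact Nat.le_mul_of_pos_right _ hk1
    omega

theorem first_intersection_height_eq_volume (d : ℕ) (hd : 1 ≤ d)
    (v0 : Fin d → ℤ) (v : Fin d → Fin d → ℤ)
    (hdist : Function.Injective (Fin.cons v0 v : Fin (d + 1) → Fin d → ℤ))
    (hnz : ∀ i : Fin (d + 1), (Fin.cons v0 v : Fin (d + 1) → Fin d → ℤ) i ≠ 0)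
    (hli : LinearIndependent ℚ (fun i (j : Fin d) => (v i j : ℚ)))
    (hgen : AddSubgroup.closure (insert 0 (insert v0 (Set.range v))) =
      (⊤ : AddSubgroup (Fin d → ℤ)))
    (H : ℕ)
    (hH : IsLeast {l : ℕ | ∃ j j' : ℕ, j < j' ∧ j' ≤ l ∧
      (truncA v0 v j l ∩ truncA v0 v j' l).Nonempty} H) :
    (H : ℝ) = (Nat.factorial d : ℝ) *
      (volume (convexHull ℝ ((fun (x : Fin d → ℤ) (i : Fin d) => (x i : ℝ)) ''
        insert 0 (insert v0 (Set.range v))))).toReal := by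
  have hliZ : LinearIndependent ℤ v := by
    rw [Fintype.linearIndependent_iff] at hli ⊢
    intro g hg i
    have := hli (fun i => (g i : ℚ)) (by
      ext j
      have := congrFun hg j
      simp only [Finset.sum_apply, Pi.smul_apply, smul_eq_mul, Pi.zero_apply] at this ⊢
      exact_mod_cast this) i
    exact_mod_cast this
  have hdet : (Matrix.of v).det ≠ 0 := by
    have h := (Matrix.linearIndependent_rows_iff_isUnit
      (A := (Matrix.of v).map (Int.castRingHom ℚ))).mp hli
    rw [Matrix.isUnit_iff_isUnit_det, ← RingHom.mapMatrix_apply, ← RingHom.map_det] at h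
    intro h0
    rw [h0] at h
    simp at h
  set D := (Matrix.of v).det.natAbs with hDdef
  have hD : 0 < D := Int.natAbs_pos.mpr hdet
  obtain ⟨b, hb⟩ := (lattice_order d v0 v hliZ hgen D).mpr dvd_rfl
  have hform := height_formula d v0 v hliZ D hD b hb
    (fun t => (lattice_order d v0 v hliZ hgen t).mp) H hH
  have hDR : (0:ℝ) < D := by exact_mod_cast hD
  let c : Fin d → ℝ := fun i => (b i : ℝ) / D
  let L : (Fin d → ℝ) →ₗ[ℝ] (Fin d → ℝ) :=
    Matrix.toLin' ((Matrix.of v).map (Int.castRingHom ℝ)).transpose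
  have hLdet : |LinearMap.det L| = D := by
    simp only [L, LinearMap.det_toLin', Matrix.det_transpose]
    rw [← RingHom.mapMatrix_apply, ← RingHom.map_det, hDdef]
    simp [Nat.cast_natAbs]
  have himg : (fun (x : Fin d → ℤ) (i : Fin d) => (x i : ℝ)) '' insert 0 (insert v0 (Set.range v)) =
      L '' (insert 0 (insert c (Set.range (fun i => Pi.single i (1:ℝ))))) := by
    simp only [Set.image_insert_eq, ← Set.range_comp, map_zero]
    congr 1
    · ext i; simp
    · congr 1
      · ext i
        have := congrFun hb i
        simp only [Finset.sum_apply, Pi.smul_apply, smul_eq_mul, nsmul_eq_mul] at this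
        have h2 : (D:ℝ) * v0 i = ∑ k, (b k : ℝ) * v k i := by exact_mod_cast this
        simp only [L, Matrix.toLin'_apply, Matrix.mulVec, dotProduct, c]
        simp only [Matrix.transpose_apply, Matrix.map_apply, Matrix.of_apply, eq_intCast]
        rw [eq_comm, ← mul_right_inj' hDR.ne', h2, Finset.mul_sum]
        apply Finset.sum_congr rfl; intro k _
        field_simp
      · congr 1; ext i j
        simp [L, Matrix.toLin'_apply]
  rw [himg, ← LinearMap.image_convexHull, Measure.addHaar_image_linearMap, volume_circuit d hd,
    hLdet, ← ENNReal.ofReal_mul hDR.le, ENNReal.toReal_ofReal]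
  · have hf : (d.factorial : ℝ) ≠ 0 := by positivity
    have hR : (H : ℝ) = D + ∑ i, max (-(b i : ℝ)) 0 + max (∑ i, (b i : ℝ) - D) 0 := by
      exact_mod_cast hform
    rw [hR]
    have e1 : ∀ i, max (-(b i : ℝ)) 0 = D * max (-c i) 0 := by
      intro i
      rw [mul_max_of_nonneg _ _ hDR.le]
      congr 1
      · simp only [c]; field_simp
      · simp
    have e2 : max (∑ i, (b i : ℝ) - D) 0 = D * max (∑ i, c i - 1) 0 := by
      rw [mul_max_of_nonneg _ _ hDR.le, mul_sub, Finset.mul_sum]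
      congr 1
      · simp only [c, mul_one]
        congr 1
        apply Finset.sum_congr rfl; intro i _
        field_simp
      · simp
    simp only [e1, e2, ← Finset.mul_sum]
    field_simp
  · have : 0 ≤ ∑ i, max (-c i) 0 := Finset.sum_nonneg fun i _ => le_max_right _ _
    positivity
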